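/- There exists an absolute constant C > 0 such that the following holds. Let (d_1,…,d_n) be positive integers with even sum such that d_max^4 ≤ (d−2)n, where d_max = max_j d_j and d = (1/n)Σ_j d_j, and let x = (x_1,…,x_n) be a suitable degree sequence. Then β(x) = exp( −μ̄(x) + E ), where |E| ≤ C · min{ d_max^4/((d−2)² n), d_max³ (ln n)/((d−2)n) }. -/

import Mathlib

attribute [local instance] Classical.propDecidable

namespace SimpleGraph

variable {V : Type*}

/-- The graph obtained from a graph on the vertices other than `v` by joining `v` to `w` only. -/
def attachLeaf (v : V) (w : {u // u ≠ v}) (G : SimpleGraph {u // u ≠ v}) : SimpleGraph V where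
  Adj a b := (∃ (ha : a ≠ v) (hb : b ≠ v), G.Adj ⟨a, ha⟩ ⟨b, hb⟩) ∨
    (a = v ∧ b = w) ∨ (a = w ∧ b = v)
  symm := ⟨by
    rintro a b (⟨ha, hb, h⟩ | ⟨h, h'⟩ | ⟨h, h'⟩)
    · exact Or.inl ⟨hb, ha, h.symm⟩
    · exact Or.inr (Or.inr ⟨h', h⟩)
    · exact Or.inr (Or.inl ⟨h', h⟩)⟩
  loopless := ⟨by
    rintro a (⟨ha, hb, h⟩ | ⟨h, h'⟩ | ⟨h, h'⟩)
    · exact G.loopless.irrefl _ h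
    · exact w.2 (h'.symm.trans h)
    · exact w.2 (h.symm.trans h')⟩

variable {v : V} {w : {u // u ≠ v}} {G : SimpleGraph {u // u ≠ v}}

theorem attachLeaf_adj_coe (a b : {u // u ≠ v}) :
    (attachLeaf v w G).Adj a b ↔ G.Adj a b := by
  simp [attachLeaf, a.2, b.2]

theorem attachLeaf_adj_left (b : {u // u ≠ v}) : (attachLeaf v w G).Adj v b ↔ b = w := by
  simp [attachLeaf, w.2.symm, Subtype.ext_iff]

theorem attachLeaf_adj_right (a : {u // u ≠ v}) : (attachLeaf v w G).Adj a v ↔ a = w := by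
  rw [adj_comm, attachLeaf_adj_left]

theorem attachLeaf_connected (hG : G.Connected) : (attachLeaf v w G).Connected := by
  let f : G →g attachLeaf v w G := ⟨Subtype.val, fun {a b} h => (attachLeaf_adj_coe a b).2 h⟩
  have hw : ∀ a, (attachLeaf v w G).Reachable a w := by
    intro a
    by_cases ha : a = v
    · rw [ha]
      exact ((attachLeaf_adj_left w).2 rfl).reachable
    · exact (hG.preconnected ⟨a, ha⟩ w).map f
  exact (connected_iff _).2 ⟨fun a b => (hw a).trans (hw b).symm, ⟨v⟩⟩

theorem attachLeaf_injective {w' : {u // u ≠ v}} {G' : SimpleGraph {u // u ≠ v}}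
    (h : attachLeaf v w G = attachLeaf v w' G') : w = w' ∧ G = G' := by
  constructor
  · rw [← attachLeaf_adj_left (G := G'), ← h, attachLeaf_adj_left]
  · ext a b
    rw [← attachLeaf_adj_coe (w := w), h, attachLeaf_adj_coe]

variable [Fintype V]

/-- The connected graphs on `V` in which every vertex `j` has degree `x j`. -/
noncomputable def connectedWithDegrees (x : V → ℕ) : Finset (SimpleGraph V) :=
  Finset.univ.filter fun G => G.Connected ∧ ∀ j, (∑ k, if G.Adj j k then 1 else 0) = x j

/-- The sum of `y i * y j` over the edges `ij` of `G`. -/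
noncomputable def edgeWeight (y : V → ℝ) (G : SimpleGraph V) : ℝ :=
  (∑ i, ∑ j, if G.Adj i j then y i * y j else 0) / 2

theorem mem_connectedWithDegrees {x : V → ℕ} {G : SimpleGraph V} :
    G ∈ connectedWithDegrees x ↔
      G.Connected ∧ ∀ j, (∑ k, if G.Adj j k then 1 else 0) = x j := by
  simp [connectedWithDegrees]

theorem edgeWeight_attachLeaf (y : V → ℝ) :
    edgeWeight y (attachLeaf v w G) = y v * y w + edgeWeight (fun u : {u // u ≠ v} => y u) G := by
  unfold edgeWeight
  rw [Fintype.sum_eq_add_sum_subtype_ne _ v]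
  simp_rw [Fintype.sum_eq_add_sum_subtype_ne _ v, attachLeaf_adj_left, attachLeaf_adj_right,
    attachLeaf_adj_coe, Finset.sum_add_distrib]
  simp only [SimpleGraph.irrefl, if_false, Finset.sum_ite_eq', Finset.mem_univ, if_true]
  ring

/-- The degrees left after removing a leaf `v` with neighbour `w`. -/
noncomputable def removeLeaf (x : V → ℕ) (v : V) (w : {u // u ≠ v}) : {u // u ≠ v} → ℕ :=
  fun u => x u - if u = w then 1 else 0

/-- Removing a vertex of degree one is a bijection onto pairs of a neighbour and a smaller graph. -/
theorem sum_connectedWithDegrees {x : V → ℕ} (hx : ∀ u, 1 ≤ x u) (hv : x v = 1)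
    (F : SimpleGraph V → ℝ) :
    ∑ G ∈ connectedWithDegrees x, F G = ∑ w : {u // u ≠ v},
      ∑ G ∈ connectedWithDegrees (removeLeaf x v w),
        F (attachLeaf v w G) := by
  rw [Finset.sum_sigma']
  symm
  refine Finset.sum_bij (fun p _ => attachLeaf v p.1 p.2) ?_ ?_ ?_ (fun _ _ => rfl)
  · rintro ⟨w, G⟩ h
    simp only [Finset.mem_sigma, Finset.mem_univ, true_and, mem_connectedWithDegrees, removeLeaf] at h ⊢
    refine ⟨attachLeaf_connected h.1, fun j => ?_⟩
    rw [Fintype.sum_eq_add_sum_subtype_ne _ v]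
    by_cases hj : j = v
    · subst hj
      simp [attachLeaf_adj_left, hv]
    · have h2 := h.2 ⟨j, hj⟩
      have h3 := attachLeaf_adj_right (w := w) (G := G) ⟨j, hj⟩
      have h4 := attachLeaf_adj_coe (w := w) (G := G) ⟨j, hj⟩
      have h5 := hx j
      simp only at h2 h3 h4
      simp only [h3, h4, h2]
      split_ifs <;> omega
  · rintro ⟨w, G⟩ _ ⟨w', G'⟩ _ h
    obtain ⟨rfl, rfl⟩ := attachLeaf_injective h
    rfl
  · intro H hH
    rw [mem_connectedWithDegrees] at hH
    have hdeg := hH.2 v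
    rw [hv, ← Finset.card_filter, Finset.card_eq_one] at hdeg
    obtain ⟨w, hw⟩ := hdeg
    have hadj : ∀ b, H.Adj v b ↔ b = w := by
      intro b
      simpa using Finset.ext_iff.1 hw b
    have hwv : w ≠ v := ((hadj w).2 rfl).ne'
    have key : attachLeaf v ⟨w, hwv⟩ (H.comap Subtype.val) = H := by
      ext a b
      by_cases ha : a = v
      · subst ha
        simp only [attachLeaf, ne_eq, comap_adj, hadj]
        simp [hwv.symm]
      · by_cases hb : b = v
        · subst hb
          rw [H.adj_comm, hadj]
          simp [attachLeaf, ha]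
        · simp [attachLeaf, ha, hb]
    refine ⟨⟨⟨w, hwv⟩, H.comap Subtype.val⟩, ?_, key⟩
    simp only [Finset.mem_sigma, Finset.mem_univ, true_and, mem_connectedWithDegrees, removeLeaf]
    constructor
    · have hd : H.degree v = 1 := by
        rw [degree_eq_one_iff_existsUnique_adj]
        exact ⟨w, (hadj w).2 rfl, fun b hb => (hadj b).1 hb⟩
      exact hH.1.induce_compl_singleton_of_degree_eq_one hd
    · intro j
      have := hH.2 j
      rw [Fintype.sum_eq_add_sum_subtype_ne _ v, H.adj_comm, hadj] at this
      simp only [comap_adj, Subtype.ext_iff]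
      omega

/-- Positive degrees that sum to twice the number of edges of a tree. -/
def IsTreeDegrees (x : V → ℕ) : Prop :=
  (∀ u, 1 ≤ x u) ∧ (∑ u, x u) + 2 = 2 * Fintype.card V

theorem IsTreeDegrees.exists_leaf {x : V → ℕ} (hx : IsTreeDegrees x) : ∃ v, x v = 1 := by
  by_contra! h
  have h2 : ∀ u ∈ Finset.univ, 2 ≤ x u := fun u _ => by
    have := hx.1 u
    have := h u
    omega
  have h3 : Fintype.card V * 2 ≤ ∑ u, x u := Finset.card_nsmul_le_sum _ _ _ h2
  have := hx.2
  omega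

theorem card_ne_add_one (v : V) : Fintype.card {u // u ≠ v} + 1 = Fintype.card V := by
  have : 0 < Fintype.card V := Fintype.card_pos_iff.2 ⟨v⟩
  simp only [ne_eq, Fintype.card_subtype_compl, Fintype.card_subtype_eq]
  omega

theorem IsTreeDegrees.removeLeaf {x : V → ℕ} (hx : IsTreeDegrees x) {v : V} (hv : x v = 1)
    {w : {u // u ≠ v}} (hw : 2 ≤ x w) : IsTreeDegrees (removeLeaf x v w) := by
  constructor
  · intro u
    have := hx.1 u
    unfold SimpleGraph.removeLeaf
    split_ifs with h
    · subst h; omega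
    · omega
  · have h1 := hx.2
    have h2 : ∑ u, SimpleGraph.removeLeaf x v w u + 1 = ∑ u : {u // u ≠ v}, x u := by
      have : ∑ u, (SimpleGraph.removeLeaf x v w u + if u = w then 1 else 0)
          = ∑ u : {u // u ≠ v}, x u := by
        refine Finset.sum_congr rfl fun u _ => ?_
        have := hx.1 u
        unfold SimpleGraph.removeLeaf
        split_ifs <;> omega
      rw [Finset.sum_add_distrib] at this
      simpa using this
    rw [Fintype.sum_eq_add_sum_subtype_ne _ v, ← card_ne_add_one v] at h1
    omega

theorem IsTreeDegrees.sum_sub_one_ne {x : V → ℕ} (hx : IsTreeDegrees x) {v : V} (hv : x v = 1) :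
    ∑ w : {u // u ≠ v}, ((x w : ℝ) - 1) = Fintype.card V - 2 := by
  have h1 := hx.2
  rw [Fintype.sum_eq_add_sum_subtype_ne _ v, hv] at h1
  have h2 := card_ne_add_one v
  rw [Finset.sum_sub_distrib]
  simp only [Finset.sum_const, Finset.card_univ, nsmul_eq_mul, mul_one]
  have h1' : (1 + ∑ w : {u // u ≠ v}, (x w : ℝ)) + 2 = 2 * (Fintype.card V : ℝ) := by
    exact_mod_cast h1
  have h2' : (Fintype.card {u // u ≠ v} : ℝ) + 1 = Fintype.card V := by exact_mod_cast h2
  linarith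

theorem eq_of_card_eq_two (hV : Fintype.card V = 2) {a b c : V} (hab : a ≠ b) (hc : c ≠ a) :
    c = b := by
  by_contra h
  have : ({a, b, c} : Finset V).card ≤ 2 := hV ▸ Finset.card_le_univ _
  rw [Finset.card_eq_three.2 ⟨a, b, c, hab, hc.symm, fun h' => h h'.symm, rfl⟩] at this
  omega

theorem IsTreeDegrees.eq_one_of_card_eq_two {x : V → ℕ} (hx : IsTreeDegrees x)
    (hV : Fintype.card V = 2) (j : V) : x j = 1 := by
  have h1 := hx.2
  rw [Fintype.sum_eq_add_sum_subtype_ne _ j] at h1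
  have h2 := Finset.card_nsmul_le_sum Finset.univ (fun u : {u // u ≠ j} => x u) 1
    (fun u _ => hx.1 u)
  have := card_ne_add_one j
  have := hx.1 j
  rw [Finset.card_univ, smul_eq_mul] at h2
  omega

theorem connectedWithDegrees_of_card_eq_two (hV : Fintype.card V = 2) {x : V → ℕ}
    (hx : IsTreeDegrees x) : connectedWithDegrees x = {⊤} := by
  have : Nontrivial V := Fintype.one_lt_card_iff_nontrivial.1 (by omega)
  ext G
  rw [mem_connectedWithDegrees, Finset.mem_singleton]
  constructor
  · rintro ⟨hG, -⟩
    ext a b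
    rw [top_adj]
    refine ⟨fun h => h.ne, fun hab => ?_⟩
    obtain ⟨c, hc⟩ := hG.preconnected.exists_adj_of_nontrivial a
    rwa [← eq_of_card_eq_two hV hab hc.ne']
  · rintro rfl
    refine ⟨connected_top, fun j => ?_⟩
    rw [Fintype.sum_eq_add_sum_subtype_ne _ j, hx.eq_one_of_card_eq_two hV]
    have := card_ne_add_one j
    have h : ∀ u : {u // u ≠ j}, j ≠ u := fun u => u.2.symm
    simp only [top_adj, h, ne_eq, not_true_eq_false, not_false_eq_true, if_true, if_false,
      Finset.sum_const, Finset.card_univ, smul_eq_mul] at this ⊢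
    omega

theorem edgeWeight_top_of_card_eq_two (hV : Fintype.card V = 2) (y : V → ℝ) (w : V) :
    edgeWeight y ⊤ = y w * (∑ u, y u - y w) := by
  have : Nontrivial V := Fintype.one_lt_card_iff_nontrivial.1 (by omega)
  obtain ⟨b, hb⟩ := exists_ne w
  have huniv : (Finset.univ : Finset V) = {w, b} := by
    ext c
    by_cases hc : c = w
    · simp [hc]
    · simp [eq_of_card_eq_two hV hb.symm hc]
  simp [edgeWeight, huniv, Finset.sum_pair hb.symm, hb, hb.symm]
  ring

theorem connectedWithDegrees_removeLeaf_eq_empty {x : V → ℕ} {v : V} {w : {u // u ≠ v}}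
    (hw : x w = 1) (hV : 3 ≤ Fintype.card V) :
    connectedWithDegrees (removeLeaf x v w) = ∅ := by
  have := card_ne_add_one v
  have : Nontrivial {u // u ≠ v} := Fintype.one_lt_card_iff_nontrivial.1 (by omega)
  refine Finset.eq_empty_of_forall_notMem fun G hG => ?_
  rw [mem_connectedWithDegrees] at hG
  obtain ⟨c, hc⟩ := hG.1.preconnected.exists_adj_of_nontrivial w
  have h := hG.2 w
  simp only [removeLeaf, hw, if_true, Nat.sub_self, Finset.sum_eq_zero_iff] at h
  have := h c (Finset.mem_univ c)
  simp [hc] at this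

theorem card_connectedWithDegrees_eq_sum {x : V → ℕ} {v : V} (hx : ∀ u, 1 ≤ x u)
    (hv : x v = 1) : (connectedWithDegrees x).card =
      ∑ w : {u // u ≠ v}, (connectedWithDegrees (removeLeaf x v w)).card := by
  have h := sum_connectedWithDegrees hx hv (fun _ => 1)
  simp only [Finset.sum_const, nsmul_eq_mul, mul_one] at h
  exact_mod_cast h

theorem prod_factorial_removeLeaf (x : V → ℕ) {v : V} {w : {u // u ≠ v}} (hw : 2 ≤ x w) :
    ∏ u : {u // u ≠ v}, (x u - 1).factorial =
      (x w - 1) * ∏ u, (removeLeaf x v w u - 1).factorial := by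
  rw [← Finset.mul_prod_erase Finset.univ _ (Finset.mem_univ w),
    ← Finset.mul_prod_erase Finset.univ (fun u => (removeLeaf x v w u - 1).factorial)
      (Finset.mem_univ w), ← mul_assoc]
  congr 1
  · simp only [removeLeaf, if_true]
    rw [Nat.mul_factorial_pred (by omega)]
  · refine Finset.prod_congr rfl fun u hu => ?_
    simp [removeLeaf, Finset.ne_of_mem_erase hu]

/-- The number of trees with given degrees is a multinomial coefficient. -/
theorem card_connectedWithDegrees_mul {k : ℕ} : ∀ {V : Type*} [Fintype V] {x : V → ℕ},
    Fintype.card V = k + 2 → IsTreeDegrees x →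
    (connectedWithDegrees x).card * ∏ u, (x u - 1).factorial = k.factorial := by
  induction k with
  | zero =>
    intro V _ x hV hx
    simp [connectedWithDegrees_of_card_eq_two hV hx, hx.eq_one_of_card_eq_two hV]
  | succ k ih =>
    intro V _ x hV hx
    obtain ⟨v, hv⟩ := hx.exists_leaf
    have hcard := card_ne_add_one v
    have hw : ∀ w : {u // u ≠ v}, (connectedWithDegrees (removeLeaf x v w)).card *
        ∏ u : {u // u ≠ v}, (x u - 1).factorial = (x w - 1) * k.factorial := by
      intro w
      rcases (hx.1 w).eq_or_lt with h | h
      · rw [connectedWithDegrees_removeLeaf_eq_empty h.symm (by omega), ← h]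
        simp
      · rw [prod_factorial_removeLeaf x h, ← ih (by omega) (hx.removeLeaf hv h)]
        ring
    have hsum : ∑ w : {u // u ≠ v}, (x w - 1) = k + 1 := by
      have h := hx.sum_sub_one_ne hv
      rw [hV] at h
      have h' : ∑ w : {u // u ≠ v}, ((x w - 1 : ℕ) : ℝ) = k + 1 := by
        simp only [Nat.cast_pred (hx.1 _), h]
        push_cast
        ring
      exact_mod_cast h'
    rw [Fintype.prod_eq_mul_prod_subtype_ne _ v, hv, card_connectedWithDegrees_eq_sum hx.1 hv]
    simp only [Nat.sub_self, Nat.factorial_zero, one_mul]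
    rw [Finset.sum_mul, Finset.sum_congr rfl fun w _ => hw w, ← Finset.sum_mul, hsum,
      Nat.factorial_succ]

theorem IsTreeDegrees.card_pos {x : V → ℕ} (hx : IsTreeDegrees x) (hV : 2 ≤ Fintype.card V) :
    0 < (connectedWithDegrees x).card := by
  obtain ⟨k, hk⟩ := Nat.exists_eq_add_of_le' hV
  have h := card_connectedWithDegrees_mul hk hx
  refine Nat.pos_of_ne_zero fun h0 => ?_
  rw [h0, zero_mul] at h
  exact (Nat.factorial_pos k).ne h

/-- The proportion of trees in which the leaf `v` is attached to `w`. -/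
theorem card_removeLeaf {k : ℕ} (hV : Fintype.card V = k + 3) {x : V → ℕ}
    (hx : IsTreeDegrees x) {v : V} (hv : x v = 1) (w : {u // u ≠ v}) :
    ((connectedWithDegrees (removeLeaf x v w)).card : ℝ) =
      (connectedWithDegrees x).card * (((x w : ℝ) - 1) / (k + 1)) := by
  have hcard := card_ne_add_one v
  have hk : (k : ℝ) + 1 ≠ 0 := by positivity
  rcases (hx.1 w).eq_or_lt with h | h
  · rw [connectedWithDegrees_removeLeaf_eq_empty h.symm (by omega), ← h]
    simp
  · have h1 := card_connectedWithDegrees_mul (k := k + 1) (by omega) hx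
    have h2 := card_connectedWithDegrees_mul (k := k) (by omega) (hx.removeLeaf hv h)
    rw [Fintype.prod_eq_mul_prod_subtype_ne _ v, hv, prod_factorial_removeLeaf x h,
      Nat.factorial_succ, ← h2] at h1
    simp only [Nat.sub_self, Nat.factorial_zero, one_mul] at h1
    have hprod : 0 < ∏ u, (removeLeaf x v w u - 1).factorial :=
      Finset.prod_pos fun u _ => Nat.factorial_pos _
    have h3 : (connectedWithDegrees x).card * (x w - 1) =
        (k + 1) * (connectedWithDegrees (removeLeaf x v w)).card :=
      Nat.eq_of_mul_eq_mul_right hprod (by linarith)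
    have h4 : ((connectedWithDegrees x).card : ℝ) * ((x w : ℝ) - 1) =
        (k + 1) * (connectedWithDegrees (removeLeaf x v w)).card := by
      rw [← Nat.cast_pred (hx.1 w)]
      exact_mod_cast h3
    rw [← mul_div_assoc, h4]
    field_simp

/-- The mean edge weight over all trees with degrees `x`, times the number of vertices minus two. -/
noncomputable def meanNumerator (x : V → ℕ) (y : V → ℝ) : ℝ :=
  ∑ i, ((x i : ℝ) - 1) * (y i * (∑ u, y u - y i))

theorem meanNumerator_eq_of_leaf {x : V → ℕ} {v : V} (hv : x v = 1) (y : V → ℝ) :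
    meanNumerator x y = meanNumerator (fun u : {u // u ≠ v} => x u) (fun u => y u) +
      ∑ w : {u // u ≠ v}, ((x w : ℝ) - 1) * (y v * y w) := by
  unfold meanNumerator
  rw [Fintype.sum_eq_add_sum_subtype_ne _ v, hv, Fintype.sum_eq_add_sum_subtype_ne y v,
    ← Finset.sum_add_distrib]
  simp only [Nat.cast_one, sub_self, zero_mul, zero_add]
  exact Finset.sum_congr rfl fun w _ => by ring

theorem meanNumerator_removeLeaf {x : V → ℕ} (hx : ∀ u, 1 ≤ x u) {v : V} (w : {u // u ≠ v})
    (y : {u // u ≠ v} → ℝ) :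
    meanNumerator (removeLeaf x v w) y =
      meanNumerator (fun u : {u // u ≠ v} => x u) y - y w * (∑ u, y u - y w) := by
  have h : ∀ u, ((removeLeaf x v w u : ℕ) : ℝ) = x u - if u = w then 1 else 0 := by
    intro u
    unfold removeLeaf
    rw [Nat.cast_sub (by split_ifs <;> simp [hx])]
    push_cast
    rfl
  unfold meanNumerator
  simp only [h, sub_right_comm _ (ite _ _ _) (1 : ℝ), sub_mul _ (ite _ _ _),
    Finset.sum_sub_distrib, ite_mul, one_mul, zero_mul, Finset.sum_ite_eq', Finset.mem_univ,
    if_true]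

/-- The conditional mean of the edge weight given that the leaf `v` is attached to `w`. -/
noncomputable def leafMean (k : ℕ) (x : V → ℕ) (y : V → ℝ) (v : V) (w : {u // u ≠ v}) : ℝ :=
  y v * y w + (meanNumerator (fun u : {u // u ≠ v} => x u) (fun u => y u) -
    y w * (∑ u : {u // u ≠ v}, y u - y w)) / k

theorem sum_leafMean {k : ℕ} (hk : 1 ≤ k) (hV : Fintype.card V = k + 3) {x : V → ℕ}
    (hx : IsTreeDegrees x) {v : V} (hv : x v = 1) (y : V → ℝ) :
    ∑ w : {u // u ≠ v}, ((x w : ℝ) - 1) / (k + 1) * leafMean k x y v w =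
      meanNumerator x y / (k + 1) := by
  have hs := hx.sum_sub_one_ne hv
  rw [hV] at hs
  push_cast at hs
  have hk0 : (k : ℝ) ≠ 0 := by positivity
  have hk1 : (k : ℝ) + 1 ≠ 0 := by positivity
  have h : ∀ w : {u // u ≠ v}, ((x w : ℝ) - 1) / (k + 1) * leafMean k x y v w =
      (((x w : ℝ) - 1) * (y v * y w) +
      ((x w : ℝ) - 1) * (meanNumerator (fun u : {u // u ≠ v} => x u) (fun u => y u) / k) -
      ((x w : ℝ) - 1) * (y w * (∑ u : {u // u ≠ v}, y u - y w)) / k) / (k + 1) := by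
    intro w
    unfold leafMean
    field_simp
    ring
  rw [Finset.sum_congr rfl fun w _ => h w, ← Finset.sum_div, Finset.sum_sub_distrib,
    Finset.sum_add_distrib, ← Finset.sum_mul, hs, ← Finset.sum_div, meanNumerator_eq_of_leaf hv]
  have h2 : ∑ w : {u // u ≠ v}, ((x w : ℝ) - 1) * (y w * (∑ u : {u // u ≠ v}, y u - y w)) =
      meanNumerator (fun u : {u // u ≠ v} => x u) (fun u => y u) := rfl
  rw [h2]
  generalize ∑ w : {u // u ≠ v}, ((x w : ℝ) - 1) * (y v * y w) = A
  congr 1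
  field_simp
  ring

theorem sum_edgeWeight {k : ℕ} : ∀ {V : Type*} [Fintype V] {x : V → ℕ},
    Fintype.card V = k + 3 → IsTreeDegrees x → ∀ y : V → ℝ,
    ∑ G ∈ connectedWithDegrees x, edgeWeight y G =
      (connectedWithDegrees x).card * (meanNumerator x y / (k + 1)) := by
  induction k with
  | zero =>
    intro V _ x hV hx y
    obtain ⟨v, hv⟩ := hx.exists_leaf
    have hcard := card_ne_add_one v
    have h : ∀ w : {u // u ≠ v},
        ∑ G ∈ connectedWithDegrees (removeLeaf x v w), edgeWeight y (attachLeaf v w G) =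
        (connectedWithDegrees x).card * (((x w : ℝ) - 1) * (y v * y w) +
          ((x w : ℝ) - 1) * (y w * (∑ u : {u // u ≠ v}, y u - y w))) := by
      intro w
      have hc := card_removeLeaf hV hx hv w
      rcases (hx.1 w).eq_or_lt with hw | hw
      · rw [connectedWithDegrees_removeLeaf_eq_empty hw.symm (by omega), ← hw]
        simp
      · rw [connectedWithDegrees_of_card_eq_two (by omega) (hx.removeLeaf hv hw)] at hc ⊢
        rw [Finset.sum_singleton, edgeWeight_attachLeaf,
          edgeWeight_top_of_card_eq_two (by omega) _ w]
        simp only [Finset.card_singleton, Nat.cast_one, CharP.cast_eq_zero, zero_add, div_one] at hc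
        rw [← mul_add, ← mul_assoc, ← hc, one_mul]
    rw [sum_connectedWithDegrees hx.1 hv, Finset.sum_congr rfl fun w _ => h w, ← Finset.mul_sum,
      Finset.sum_add_distrib, meanNumerator_eq_of_leaf hv, meanNumerator]
    simp only [CharP.cast_eq_zero, zero_add, div_one]
    rw [add_comm]
  | succ k ih =>
    intro V _ x hV hx y
    obtain ⟨v, hv⟩ := hx.exists_leaf
    have hcard := card_ne_add_one v
    have h : ∀ w : {u // u ≠ v},
        ∑ G ∈ connectedWithDegrees (removeLeaf x v w), edgeWeight y (attachLeaf v w G) =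
        (connectedWithDegrees x).card *
          (((x w : ℝ) - 1) / ((k + 1 : ℕ) + 1) * leafMean (k + 1) x y v w) := by
      intro w
      rcases (hx.1 w).eq_or_lt with hw | hw
      · rw [connectedWithDegrees_removeLeaf_eq_empty hw.symm (by omega), ← hw]
        simp
      · simp only [edgeWeight_attachLeaf, Finset.sum_add_distrib, Finset.sum_const, nsmul_eq_mul]
        rw [ih (by omega) (hx.removeLeaf hv hw), meanNumerator_removeLeaf hx.1, ← mul_add,
          card_removeLeaf hV hx hv w, leafMean, mul_assoc]
        push_cast
        rfl
    rw [sum_connectedWithDegrees hx.1 hv, Finset.sum_congr rfl fun w _ => h w, ← Finset.mul_sum,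
      sum_leafMean (by omega) hV hx hv]

theorem exp_le_cosh_add {t r : ℝ} (h : |t| ≤ r) :
    Real.exp t ≤ Real.cosh r + t * (Real.sinh r / r) := by
  rcases (abs_nonneg t).trans h |>.eq_or_lt with hr | hr
  · have : t = 0 := abs_eq_zero.1 (le_antisymm (hr ▸ h) (abs_nonneg t))
    simp [this, ← hr]
  · have ht := abs_le.1 h
    have h1 : 0 ≤ (r + t) / (2 * r) := div_nonneg (by linarith) (by linarith)
    have h2 : 0 ≤ (r - t) / (2 * r) := div_nonneg (by linarith) (by linarith)
    have hc := convexOn_exp.2 (Set.mem_univ r) (Set.mem_univ (-r)) h1 h2 (by field_simp; ring)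
    have he : ((r + t) / (2 * r)) • r + ((r - t) / (2 * r)) • (-r) = t := by
      simp only [smul_eq_mul]
      field_simp
      ring
    rw [he] at hc
    refine hc.trans (le_of_eq ?_)
    rw [Real.cosh_eq, Real.sinh_eq]
    simp only [smul_eq_mul]
    field_simp
    ring

/-- A weak form of Hoeffding's lemma for finitely supported random variables. -/
theorem sum_mul_exp_neg_le {ι : Type*} [Fintype ι] {p g : ι → ℝ} (hp : ∀ i, 0 ≤ p i)
    (hp1 : ∑ i, p i = 1) {lo hi : ℝ} (hlo : ∀ i, lo ≤ g i) (hhi : ∀ i, g i ≤ hi) :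
    ∑ i, p i * Real.exp (-g i) ≤ Real.exp (-∑ i, p i * g i + (hi - lo) ^ 2 / 2) := by
  set m := ∑ i, p i * g i with hm
  have hmlo : lo ≤ m := by
    calc lo = ∑ i, p i * lo := by rw [← Finset.sum_mul, hp1, one_mul]
      _ ≤ m := Finset.sum_le_sum fun i _ => mul_le_mul_of_nonneg_left (hlo i) (hp i)
  have hmhi : m ≤ hi := by
    calc m ≤ ∑ i, p i * hi :=
          Finset.sum_le_sum fun i _ => mul_le_mul_of_nonneg_left (hhi i) (hp i)
      _ = hi := by rw [← Finset.sum_mul, hp1, one_mul]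
  have hzero : ∑ i, p i * (m - g i) = 0 := by
    simp only [mul_sub, Finset.sum_sub_distrib, ← Finset.sum_mul, hp1, one_mul]
    exact sub_self m
  calc ∑ i, p i * Real.exp (-g i)
      = Real.exp (-m) * ∑ i, p i * Real.exp (m - g i) := by
        rw [Finset.mul_sum]
        refine Finset.sum_congr rfl fun i _ => ?_
        rw [mul_left_comm, ← Real.exp_add]
        congr 2
        ring
    _ ≤ Real.exp (-m) * ∑ i, p i * (Real.cosh (hi - lo) +
          (m - g i) * (Real.sinh (hi - lo) / (hi - lo))) := by
        gcongr with i
        · exact hp i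
        · refine exp_le_cosh_add (abs_le.2 ⟨?_, ?_⟩) <;> linarith [hlo i, hhi i]
    _ = Real.exp (-m) * Real.cosh (hi - lo) := by
        simp only [mul_add, ← mul_assoc, Finset.sum_add_distrib, ← Finset.sum_mul, hp1, hzero]
        ring
    _ ≤ Real.exp (-m + (hi - lo) ^ 2 / 2) := by
        rw [Real.exp_add]
        exact mul_le_mul_of_nonneg_left (Real.cosh_le_exp_half_sq _) (Real.exp_pos _).le

theorem leafMean_range {k : ℕ} (hk : 1 ≤ k) {y : V → ℝ} {D : ℝ} (hy : ∀ u, 0 ≤ y u)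
    (hyD : ∀ u, y u ≤ D) (x : V → ℕ) (v : V) (w : {u // u ≠ v}) :
    let K := meanNumerator (fun u : {u // u ≠ v} => x u) (fun u => y u) / k
    K - D * ((∑ u : {u // u ≠ v}, y u) / k) ≤ leafMean k x y v w ∧
      leafMean k x y v w ≤ K + D * y v := by
  intro K
  have hk0 : (0 : ℝ) < k := by positivity
  have hwY : y w ≤ ∑ u : {u // u ≠ v}, y u :=
    Finset.single_le_sum (f := fun u : {u // u ≠ v} => y u) (fun u _ => hy u) (Finset.mem_univ w)
  have hlm : leafMean k x y v w =
      K + y v * y w - y w * ((∑ u : {u // u ≠ v}, y u - y w) / k) := by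
    simp only [leafMean, K]
    ring
  rw [hlm]
  have h1 : 0 ≤ y v * y w := mul_nonneg (hy v) (hy w)
  have h2 : y v * y w ≤ D * y v := by
    rw [mul_comm]
    exact mul_le_mul_of_nonneg_right (hyD w) (hy v)
  have h3 : 0 ≤ y w * ((∑ u : {u // u ≠ v}, y u - y w) / k) :=
    mul_nonneg (hy w) (div_nonneg (sub_nonneg.2 hwY) hk0.le)
  have h4 : y w * ((∑ u : {u // u ≠ v}, y u - y w) / k) ≤
      D * ((∑ u : {u // u ≠ v}, y u) / k) := by
    have := hy w
    refine mul_le_mul (hyD w) ?_ (div_nonneg (sub_nonneg.2 hwY) hk0.le) ((hy v).trans (hyD v))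
    gcongr
    linarith
  constructor <;> linarith

/-- The scale-free bound on the logarithm of the exponential moment of the centred edge weight
for trees on `k + 2` vertices. -/
noncomputable def momentError (D S q : ℝ) (k : ℕ) : ℝ :=
  D ^ 2 * (q + 9 * ∑ j ∈ Finset.Ico 1 k, min (D ^ 2) (D * S / (j + 2)))

theorem sq_div_le_min {D S Y : ℝ} {k : ℕ} (hk : 1 ≤ k) (hD : 0 ≤ D) (hY : 0 ≤ Y) (hYS : Y ≤ S)
    (hYD : Y ≤ (k + 2) * D) : (Y / k) ^ 2 ≤ 9 * min (D ^ 2) (D * S / (k + 2)) := by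
  have hk1 : (1 : ℝ) ≤ k := by exact_mod_cast hk
  have h1 : Y / k ≤ 3 * (Y / (k + 2)) := by
    rw [← mul_div_assoc, div_le_div_iff₀ (by positivity) (by positivity)]
    nlinarith
  have h2 : Y / (k + 2) ≤ D := by
    rw [div_le_iff₀ (by positivity)]
    linarith
  have h3 : Y / (k + 2) ≤ S / (k + 2) := by gcongr
  have h0 : 0 ≤ Y / (k + 2) := by positivity
  have h4 : (Y / k) ^ 2 ≤ 9 * (Y / (k + 2)) ^ 2 := by
    calc (Y / k) ^ 2 ≤ (3 * (Y / (k + 2))) ^ 2 := by gcongr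
      _ = _ := by ring
  refine h4.trans (mul_le_mul_of_nonneg_left (le_min (by gcongr) ?_) (by norm_num))
  rw [mul_div_assoc, sq]
  gcongr

theorem momentError_nonneg {D S q : ℝ} (hD : 0 ≤ D) (hS : 0 ≤ S) (hq : 0 ≤ q) (k : ℕ) :
    0 ≤ momentError D S q k := by
  have : 0 ≤ ∑ j ∈ Finset.Ico 1 k, min (D ^ 2) (D * S / (j + 2)) :=
    Finset.sum_nonneg fun j _ => le_min (by positivity) (by positivity)
  unfold momentError
  positivity

theorem sum_exp_neg_edgeWeight_le_of_card_eq_one {x : V → ℕ}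
    (h : (connectedWithDegrees x).card = 1) (y : V → ℝ) {a e : ℝ} (he : 0 ≤ e) :
    ∑ G ∈ connectedWithDegrees x, Real.exp (-(a * edgeWeight y G)) ≤
      (connectedWithDegrees x).card * Real.exp (-(a *
        ((∑ G ∈ connectedWithDegrees x, edgeWeight y G) / (connectedWithDegrees x).card)) + e) := by
  obtain ⟨T, hT⟩ := Finset.card_eq_one.1 h
  simpa [hT] using he

theorem sum_exp_neg_edgeWeight_le {a D S : ℝ} (ha : 0 ≤ a) (hS : 0 ≤ S) {k : ℕ} :
    ∀ {V : Type*} [Fintype V] {x : V → ℕ} {y : V → ℝ},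
    Fintype.card V = k + 2 → IsTreeDegrees x → (∀ u, 0 ≤ y u) → (∀ u, y u ≤ D) → ∑ u, y u ≤ S →
    ∑ G ∈ connectedWithDegrees x, Real.exp (-(a * edgeWeight y G)) ≤
      (connectedWithDegrees x).card * Real.exp (-(a *
        ((∑ G ∈ connectedWithDegrees x, edgeWeight y G) / (connectedWithDegrees x).card)) +
        a ^ 2 * momentError D S (∑ u, y u ^ 2) k) := by
  induction k with
  | zero =>
    intro V _ x y hV hx hy hyD hyS
    obtain ⟨v, -⟩ := hx.exists_leaf
    exact sum_exp_neg_edgeWeight_le_of_card_eq_one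
      (by rw [connectedWithDegrees_of_card_eq_two hV hx, Finset.card_singleton]) y
      (mul_nonneg (sq_nonneg a) (momentError_nonneg ((hy v).trans (hyD v)) hS
        (Finset.sum_nonneg fun u _ => sq_nonneg _) _))
  | succ k ih =>
    intro V _ x y hV hx hy hyD hyS
    obtain ⟨v, hv⟩ := hx.exists_leaf
    have hcard := card_ne_add_one v
    have hD : 0 ≤ D := (hy v).trans (hyD v)
    rcases Nat.eq_zero_or_pos k with rfl | hk
    · have h := card_connectedWithDegrees_mul hV hx
      exact sum_exp_neg_edgeWeight_le_of_card_eq_one (Nat.eq_one_of_mul_eq_one_right h) y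
        (mul_nonneg (sq_nonneg a) (momentError_nonneg hD hS
          (Finset.sum_nonneg fun u _ => sq_nonneg _) _))
    have hc : (0 : ℝ) < (connectedWithDegrees x).card := by
      exact_mod_cast hx.card_pos (by omega)
    set c : ℝ := ((connectedWithDegrees x).card : ℝ)
    set Q := ∑ u : {u // u ≠ v}, y u ^ 2 with hQ
    set Y := ∑ u : {u // u ≠ v}, y u with hY
    have hY0 : 0 ≤ Y := Finset.sum_nonneg fun u _ => hy u
    have hYS : Y ≤ S := by
      rw [Fintype.sum_eq_add_sum_subtype_ne _ v] at hyS
      linarith [hy v]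
    have hYD : Y ≤ (k + 2) * D := by
      have h := Finset.sum_le_card_nsmul Finset.univ (fun u : {u // u ≠ v} => y u) D
        (fun u _ => hyD u)
      rw [Finset.card_univ, nsmul_eq_mul, show Fintype.card {u // u ≠ v} = k + 2 by omega] at h
      exact_mod_cast h
    set p : {u // u ≠ v} → ℝ := fun w => ((x w : ℝ) - 1) / (k + 1) with hp
    have hstep : ∀ w : {u // u ≠ v}, ∑ G ∈ connectedWithDegrees (removeLeaf x v w),
        Real.exp (-(a * edgeWeight y (attachLeaf v w G))) ≤
        c * Real.exp (a ^ 2 * momentError D S Q k) *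
          (p w * Real.exp (-(a * leafMean k x y v w))) := by
      intro w
      rcases (hx.1 w).eq_or_lt with hw | hw
      · rw [connectedWithDegrees_removeLeaf_eq_empty hw.symm (by omega)]
        simp [hp, ← hw]
      · have hx' := hx.removeLeaf hv hw
        have hi := ih (y := fun u : {u // u ≠ v} => y u) (by omega) hx' (fun u => hy u)
          (fun u => hyD u) hYS
        obtain ⟨j, rfl⟩ := Nat.exists_eq_add_of_le' hk
        have hc' : ((connectedWithDegrees (removeLeaf x v w)).card : ℝ) ≠ 0 := by
          have := hx'.card_pos (by omega)
          positivity
        rw [sum_edgeWeight (k := j) (by omega) hx', mul_div_cancel_left₀ _ hc',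
          meanNumerator_removeLeaf hx.1, card_removeLeaf (by omega) hx hv w] at hi
        simp only [edgeWeight_attachLeaf, mul_add, neg_add, Real.exp_add, ← Finset.mul_sum]
        refine (mul_le_mul_of_nonneg_left hi (Real.exp_pos _).le).trans (le_of_eq ?_)
        simp only [leafMean, mul_add, neg_add, Real.exp_add, hp, hQ, c]
        push_cast
        ring
    have hp0 : ∀ w, 0 ≤ p w := fun w => by
      have : (1 : ℝ) ≤ x w := by exact_mod_cast hx.1 w
      exact div_nonneg (by linarith) (by positivity)
    have hp1 : ∑ w, p w = 1 := by
      rw [hp, ← Finset.sum_div, hx.sum_sub_one_ne hv, hV]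
      push_cast
      field_simp
      ring
    have hmean : ∑ w, p w * (a * leafMean k x y v w) =
        a * ((∑ G ∈ connectedWithDegrees x, edgeWeight y G) / c) := by
      obtain ⟨j, rfl⟩ := Nat.exists_eq_add_of_le' hk
      rw [sum_edgeWeight (k := j + 1) (by omega) hx, mul_div_cancel_left₀ _ hc.ne',
        ← sum_leafMean hk (by omega) hx hv, Finset.mul_sum]
      exact Finset.sum_congr rfl fun w _ => by ring
    have hhoeff := sum_mul_exp_neg_le hp0 hp1
      (fun w => mul_le_mul_of_nonneg_left (leafMean_range hk hy hyD x v w).1 ha)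
      (fun w => mul_le_mul_of_nonneg_left (leafMean_range hk hy hyD x v w).2 ha)
    rw [hmean] at hhoeff
    rw [sum_connectedWithDegrees hx.1 hv]
    refine (Finset.sum_le_sum fun w _ => hstep w).trans ?_
    rw [← Finset.mul_sum]
    refine (mul_le_mul_of_nonneg_left hhoeff (by positivity)).trans ?_
    rw [mul_assoc, ← Real.exp_add]
    refine mul_le_mul_of_nonneg_left (Real.exp_le_exp.2 ?_) hc.le
    have hsq := sq_div_le_min hk hD hY0 hYS hYD
    have hQv : ∑ u, y u ^ 2 = y v ^ 2 + Q := Fintype.sum_eq_add_sum_subtype_ne _ v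
    rw [hQv, momentError, momentError, Finset.sum_Ico_succ_top hk]
    have hsq2 : (y v + Y / k) ^ 2 / 2 ≤ y v ^ 2 + (Y / k) ^ 2 := by
      nlinarith [sq_nonneg (y v - Y / k)]
    have hfin := mul_le_mul_of_nonneg_left
      (hsq2.trans (add_le_add_right hsq (y v ^ 2))) (by positivity : 0 ≤ a ^ 2 * D ^ 2)
    rw [← hY]
    nlinarith [hfin]

theorem two_mul_sum_edgeFinset (G : SimpleGraph V) [Fintype G.edgeSet] (g : Sym2 V → ℝ) :
    2 * ∑ e ∈ G.edgeFinset, g e = ∑ i, ∑ j, if G.Adj i j then g s(i, j) else 0 := by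
  have h1 : ∑ d : G.Dart, g d.edge = 2 * ∑ e ∈ G.edgeFinset, g e := by
    rw [← Finset.sum_fiberwise_of_maps_to (t := G.edgeFinset) (g := fun d : G.Dart => d.edge)
      (fun d _ => mem_edgeFinset.2 d.edge_mem), Finset.mul_sum]
    refine Finset.sum_congr rfl fun e he => ?_
    have hcard := G.dart_edge_fiber_card e (mem_edgeFinset.1 he)
    rw [Finset.sum_congr rfl (g := fun _ => g e)
      (fun d hd => by rw [(Finset.mem_filter.1 hd).2]), Finset.sum_const, nsmul_eq_mul, hcard]
    norm_num
  rw [← h1, ← Fintype.sum_prod_type' (f := fun i j => if G.Adj i j then g s(i, j) else 0),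
    ← Finset.sum_filter]
  refine Finset.sum_bij (fun d _ => d.toProd) (fun d _ => ?_) (fun d _ d' _ h => ?_)
    (fun p hp => ?_) (fun d _ => rfl)
  · simp
  · exact Dart.ext _ _ h
  · exact ⟨⟨p, (Finset.mem_filter.1 hp).2⟩, Finset.mem_univ _, rfl⟩

theorem sum_Ico_one_div_le_log {k : ℕ} :
    ∑ j ∈ Finset.Ico 1 k, 1 / ((j : ℝ) + 2) ≤ Real.log (k + 1) := by
  induction k with
  | zero => simp
  | succ k ih =>
    rcases Nat.eq_zero_or_pos k with rfl | hk
    · simpa using Real.log_nonneg (by norm_num : (1 : ℝ) ≤ 1 + 1)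
    · rw [Finset.sum_Ico_succ_top hk]
      have h := Real.one_sub_inv_le_log_of_pos (by positivity : 0 < ((k : ℝ) + 2) / (k + 1))
      rw [Real.log_div (by positivity) (by positivity)] at h
      have h2 : 1 - (((k : ℝ) + 2) / (k + 1))⁻¹ = 1 / (k + 2) := by
        field_simp
        ring
      push_cast
      rw [show (k : ℝ) + 1 + 1 = k + 2 by ring]
      linarith

theorem momentError_le_card {D S q : ℝ} {k : ℕ} (hq : q ≤ (k + 2) * D ^ 2) :
    momentError D S q k ≤ 10 * ((k + 2) * D ^ 4) := by
  have h : ∑ j ∈ Finset.Ico 1 k, min (D ^ 2) (D * S / (j + 2)) ≤ (k + 2) * D ^ 2 := by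
    calc _ ≤ ∑ j ∈ Finset.Ico 1 k, D ^ 2 := Finset.sum_le_sum fun j _ => min_le_left _ _
      _ = (k - 1 : ℕ) * D ^ 2 := by simp
      _ ≤ (k + 2) * D ^ 2 := by
        gcongr
        exact_mod_cast (by omega : k - 1 ≤ k + 2)
  calc momentError D S q k ≤ D ^ 2 * ((k + 2) * D ^ 2 + 9 * ((k + 2) * D ^ 2)) := by
        unfold momentError
        gcongr
    _ = _ := by ring

theorem momentError_le_log {D S q : ℝ} {k : ℕ} (hD : 0 ≤ D) (hS : 0 ≤ S) (hq : q ≤ D * S) :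
    momentError D S q k ≤ 11 * (D ^ 3 * S * Real.log (k + 2)) := by
  have hlog : 1 / 2 ≤ Real.log (k + 2) := by
    have h := Real.log_two_gt_d9
    have h2 : Real.log 2 ≤ Real.log (k + 2) := Real.log_le_log (by norm_num) (by simp)
    linarith
  have h : ∑ j ∈ Finset.Ico 1 k, min (D ^ 2) (D * S / (j + 2)) ≤ D * S * Real.log (k + 2) := by
    calc _ ≤ ∑ j ∈ Finset.Ico 1 k, D * S * (1 / ((j : ℝ) + 2)) :=
          Finset.sum_le_sum fun j _ => (min_le_right _ _).trans (le_of_eq (by ring))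
      _ = D * S * ∑ j ∈ Finset.Ico 1 k, 1 / ((j : ℝ) + 2) := by rw [Finset.mul_sum]
      _ ≤ D * S * Real.log (k + 1) := by
        gcongr
        exact sum_Ico_one_div_le_log
      _ ≤ D * S * Real.log (k + 2) := by
        gcongr
        norm_num
  have hDS : D * S ≤ 2 * (D * S * Real.log (k + 2)) := by
    nlinarith [mul_nonneg hD hS]
  calc momentError D S q k
      ≤ D ^ 2 * (2 * (D * S * Real.log (k + 2)) + 9 * (D * S * Real.log (k + 2))) := by
        unfold momentError
        gcongr
        linarith
    _ = _ := by ring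

theorem isTree_and_degree_iff {x : V → ℕ} (hx : IsTreeDegrees x) {T : SimpleGraph V}
    [T.LocallyFinite] :
    (T.IsTree ∧ ∀ j, T.degree j = x j) ↔ T ∈ connectedWithDegrees x := by
  have hdeg : ∀ j, T.degree j = ∑ k, if T.Adj j k then 1 else 0 := by
    intro j
    rw [← Finset.card_filter, ← card_neighborFinset_eq_degree]
    congr 1
    ext k
    simp
  rw [mem_connectedWithDegrees]
  refine ⟨fun h => ⟨h.1.connected, fun j => hdeg j ▸ h.2 j⟩, fun h => ?_⟩
  have hd : ∀ j, T.degree j = x j := fun j => (hdeg j).trans (h.2 j)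
  refine ⟨isTree_iff_connected_and_card.2 ⟨h.1, ?_⟩, hd⟩
  have hs := T.sum_degrees_eq_twice_card_edges
  have hsum : ∑ j, x j = 2 * T.edgeFinset.card := by
    rw [← hs]
    refine Finset.sum_congr rfl fun j _ => ?_
    rw [← hd j]
    congr!
  have := hx.2
  rw [Nat.card_eq_fintype_card, Nat.card_eq_fintype_card, ← edgeFinset_card]
  omega

end SimpleGraph

/-- Jensen lower bound combined with a given upper bound on an exponential average. -/
theorem exists_exp_error {ι : Type*} {s : Finset ι} (hs : s.Nonempty) (f : ι → ℝ) {B : ℝ}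
    (h : ∑ i ∈ s, Real.exp (-f i) ≤ s.card * Real.exp (-((∑ i ∈ s, f i) / s.card) + B)) :
    ∃ E, 0 ≤ E ∧ E ≤ B ∧
      (∑ i ∈ s, Real.exp (-f i)) / s.card = Real.exp (-((∑ i ∈ s, f i) / s.card) + E) := by
  have hc : (0 : ℝ) < s.card := by exact_mod_cast hs.card_pos
  set m := (∑ i ∈ s, f i) / s.card with hm
  set b := (∑ i ∈ s, Real.exp (-f i)) / s.card with hb
  have hb0 : 0 < b := div_pos (Finset.sum_pos (fun i _ => Real.exp_pos _) hs) hc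
  have hlow : Real.exp (-m) ≤ b := by
    rw [hb, le_div_iff₀ hc]
    calc Real.exp (-m) * s.card = ∑ i ∈ s, Real.exp (-m) * (1 + (m - f i)) := by
          rw [← Finset.mul_sum, Finset.sum_add_distrib, Finset.sum_sub_distrib]
          simp only [Finset.sum_const, nsmul_eq_mul, mul_one]
          rw [hm, mul_div_cancel₀ _ hc.ne']
          ring
      _ ≤ ∑ i ∈ s, Real.exp (-f i) := by
          refine Finset.sum_le_sum fun i _ => ?_
          rw [show -f i = -m + (m - f i) by ring, Real.exp_add]
          gcongr
          linarith [Real.add_one_le_exp (m - f i)]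
  have hup : b ≤ Real.exp (-m + B) := by
    rw [hb, div_le_iff₀ hc, mul_comm]
    exact h
  refine ⟨Real.log b + m, ?_, ?_, ?_⟩
  · have := (Real.le_log_iff_exp_le hb0).2 hlow
    linarith
  · have := (Real.log_le_iff_le_exp hb0).2 hup
    linarith
  · rw [show -m + (Real.log b + m) = Real.log b by ring, Real.exp_log hb0]

open SimpleGraph

theorem beta_approx :
    ∃ C : ℝ, 0 < C ∧ ∀ n : ℕ, ∀ dseq xseq : Fin n → ℕ,
      (∀ j, 1 ≤ dseq j) → Even (∑ j, dseq j) →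
      -- `xseq` is a suitable degree sequence
      (∀ j, 1 ≤ xseq j) → (∀ j, xseq j ≤ dseq j) → (∑ j, xseq j) + 2 = 2 * n →
      ∀ dmax davg : ℝ,
      dmax = (Finset.univ.sup dseq : ℕ) →
      davg = (∑ j, (dseq j : ℝ)) / n →
      dmax ^ 4 ≤ (davg - 2) * n →
      ∀ mu : SimpleGraph (Fin n) → ℝ,
      (∀ T : SimpleGraph (Fin n),
        mu T = (∑ e ∈ T.edgeFinset,
            Sym2.lift ⟨fun i j => ((dseq i - xseq i : ℕ) : ℝ) * ((dseq j - xseq j : ℕ) : ℝ),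
              fun i j => by ring⟩ e) / ((davg - 2) * n + 2)) →
      ∀ Tx : Finset (SimpleGraph (Fin n)),
      Tx = Finset.univ.filter
        (fun T : SimpleGraph (Fin n) => T.IsTree ∧ ∀ j, T.degree j = xseq j) →
      ∀ β mubar : ℝ,
      β = (∑ T ∈ Tx, Real.exp (-mu T)) / (Tx.card : ℝ) →
      mubar = (∑ T ∈ Tx, mu T) / (Tx.card : ℝ) →
      ∃ E : ℝ,
        |E| ≤ C * min (dmax ^ 4 / ((davg - 2) ^ 2 * n))
            (dmax ^ 3 * Real.log n / ((davg - 2) * n)) ∧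
        β = Real.exp (-mubar + E) := by
  refine ⟨11, by norm_num, ?_⟩
  intro n dseq xseq hd _ hx hxd hsum dmax davg hdmax hdavg hbig mu hmu Tx hTx β mubar hβ hmubar
  have hn : 2 ≤ n := by
    have h : Fintype.card (Fin n) * 1 ≤ ∑ j, xseq j :=
      Finset.card_nsmul_le_sum _ _ _ fun j _ => hx j
    rw [Fintype.card_fin] at h
    omega
  obtain ⟨k, rfl⟩ := Nat.exists_eq_add_of_le' hn
  have htree : IsTreeDegrees xseq := ⟨hx, by rw [Fintype.card_fin]; exact hsum⟩
  have hcard : Fintype.card (Fin (k + 2)) = k + 2 := Fintype.card_fin _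
  set y : Fin (k + 2) → ℝ := fun j => ((dseq j - xseq j : ℕ) : ℝ) with hy
  set s : ℝ := (davg - 2) * ((k + 2 : ℕ) : ℝ) with hs
  have hle : ∀ j, dseq j ≤ Finset.univ.sup dseq := fun j => Finset.le_sup (Finset.mem_univ j)
  have hdmax1 : 1 ≤ dmax := by
    rw [hdmax]
    exact_mod_cast (hd 0).trans (hle 0)
  have hs1 : 1 ≤ s := (one_le_pow₀ hdmax1).trans hbig
  have hy0 : ∀ j, 0 ≤ y j := fun j => Nat.cast_nonneg _
  have hyD : ∀ j, y j ≤ dmax := fun j => by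
    rw [hdmax]
    exact Nat.cast_le.2 ((Nat.sub_le _ _).trans (hle j))
  have hyS : ∑ j, y j = s + 2 := by
    have hsum' : (∑ j, (xseq j : ℝ)) + 2 = 2 * ((k + 2 : ℕ) : ℝ) := by exact_mod_cast hsum
    have hd' : davg * ((k + 2 : ℕ) : ℝ) = ∑ j, (dseq j : ℝ) := by
      rw [hdavg, div_mul_cancel₀ _ (by positivity)]
    simp only [hy, Nat.cast_sub (hxd _), Finset.sum_sub_distrib]
    rw [hs, sub_mul, hd']
    linarith
  have hmuW : ∀ T, mu T = (s + 2)⁻¹ * edgeWeight y T := by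
    intro T
    rw [hmu, edgeWeight, inv_mul_eq_div]
    congr 1
    have h2 := two_mul_sum_edgeFinset T (Sym2.lift ⟨fun i j => y i * y j, fun i j => by ring⟩)
    simp only [Sym2.lift_mk] at h2
    rw [eq_div_iff two_ne_zero, mul_comm, ← h2]
  have hTx' : Tx = connectedWithDegrees xseq := by
    rw [hTx]
    ext T
    rw [Finset.mem_filter, isTree_and_degree_iff htree]
    simp
  have hmain := sum_exp_neg_edgeWeight_le (a := (s + 2)⁻¹) (by positivity)
    (by linarith : 0 ≤ s + 2) hcard htree hy0 hyD hyS.le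
  rw [← mul_div_assoc, Finset.mul_sum, ← hTx'] at hmain
  simp only [← hmuW] at hmain
  obtain ⟨E, hE0, hEB, hE⟩ := exists_exp_error
    (Finset.card_pos.1 (hTx' ▸ htree.card_pos (by omega))) mu hmain
  refine ⟨E, ?_, by rw [hβ, hmubar, hE]⟩
  rw [abs_of_nonneg hE0]
  refine hEB.trans ?_
  have hq1 : ∑ u, y u ^ 2 ≤ (k + 2) * dmax ^ 2 := by
    have h := Finset.sum_le_card_nsmul Finset.univ (fun u => y u ^ 2) (dmax ^ 2)
      (fun u _ => pow_le_pow_left₀ (hy0 u) (hyD u) 2)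
    rw [Finset.card_univ, nsmul_eq_mul, hcard] at h
    exact_mod_cast h
  have hq2 : ∑ u, y u ^ 2 ≤ dmax * (s + 2) := by
    rw [← hyS, Finset.mul_sum]
    refine Finset.sum_le_sum fun u _ => ?_
    rw [sq]
    exact mul_le_mul_of_nonneg_right (hyD u) (hy0 u)
  rw [mul_min_of_nonneg _ _ (by norm_num)]
  have hsq : (s + 2)⁻¹ ^ 2 ≤ s⁻¹ ^ 2 := by
    gcongr
    linarith
  refine le_min ?_ ?_
  · calc (s + 2)⁻¹ ^ 2 * momentError dmax (s + 2) (∑ u, y u ^ 2) k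
        ≤ s⁻¹ ^ 2 * (11 * ((k + 2) * dmax ^ 4)) := by
          refine mul_le_mul hsq ((momentError_le_card hq1).trans ?_)
            (momentError_nonneg (by linarith) (by linarith)
              (Finset.sum_nonneg fun u _ => sq_nonneg _) k) (by positivity)
          gcongr
          norm_num
      _ = 11 * (dmax ^ 4 / ((davg - 2) ^ 2 * ((k + 2 : ℕ) : ℝ))) := by
          have hd2 : davg - 2 ≠ 0 := by
            rintro h
            rw [hs, h, zero_mul] at hs1
            linarith
          rw [hs]
          push_cast
          field_simp
  · calc (s + 2)⁻¹ ^ 2 * momentError dmax (s + 2) (∑ u, y u ^ 2) k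
        ≤ (s + 2)⁻¹ ^ 2 * (11 * (dmax ^ 3 * (s + 2) * Real.log (k + 2))) := by
          gcongr
          exact momentError_le_log (by linarith) (by linarith) hq2
      _ = 11 * (dmax ^ 3 * Real.log (k + 2) / (s + 2)) := by
          field_simp
      _ ≤ 11 * (dmax ^ 3 * Real.log (k + 2) / s) := by
          have : 0 ≤ Real.log ((k : ℝ) + 2) := Real.log_nonneg (by linarith [k.cast_nonneg (α := ℝ)])
          gcongr
          linarith
      _ = _ := by push_cast; rfl
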